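/- Let n ≥ 1, let a ∈ 𝒮(ℝ^{2n}), λ ∈ ℂ, and let U ∈ 𝒮(ℝ^{2n}) satisfy Ã U = λ U, where Ã is the phase-space operator associated with Ω = J and symbol a. For φ ∈ 𝒮(ℝ^n) define u_φ(x) = (2/π)^{n/2} ∫_{ℝ^{2n}} U(z₀) e^{2iξ₀·(x−x₀)} φ(2x₀ − x) dz₀ (i.e. u_φ = W_φ* U). Then: (i) for every φ ∈ 𝒮(ℝ^n), Â u_φ = λ u_φ, where Â is the Weyl operator with symbol a; and (ii) if U ≠ 0 then there exists φ ∈ 𝒮(ℝ^n) with u_φ ≠ 0, so λ is an eigenvalue of Â. -/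

import Mathlib

open MeasureTheory Matrix ComplexConjugate

/-- The standard symplectic form `σ(z,z') = ξ·x' − ξ'·x` for `z = (x,ξ)`. -/
noncomputable def sigmaForm {n : ℕ}
    (z z' : (Fin n → ℝ) × (Fin n → ℝ)) : ℝ :=
  z.2 ⬝ᵥ z'.1 - z'.2 ⬝ᵥ z.1

/-- The symplectic Fourier transform `F_σ`. -/
noncomputable def Fsigma {n : ℕ} (a : ((Fin n → ℝ) × (Fin n → ℝ)) → ℂ)
    (z : (Fin n → ℝ) × (Fin n → ℝ)) : ℂ :=
  ((((2 * Real.pi) ^ n : ℝ)⁻¹ : ℝ) : ℂ) *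
    ∫ z' : (Fin n → ℝ) × (Fin n → ℝ),
      Complex.exp (-Complex.I * ((sigmaForm z z' : ℝ) : ℂ)) * a z'

/-- The phase-space operator `Ã` (with `Ω = J`, i.e. `ω = σ`) with symbol `a`. -/
noncomputable def AtildeSigma {n : ℕ} (a U : ((Fin n → ℝ) × (Fin n → ℝ)) → ℂ)
    (z : (Fin n → ℝ) × (Fin n → ℝ)) : ℂ :=
  ((((2 * Real.pi) ^ n : ℝ)⁻¹ : ℝ) : ℂ) *
    ∫ z₀ : (Fin n → ℝ) × (Fin n → ℝ),
      Fsigma a z₀ * Complex.exp (-Complex.I * ((sigmaForm z z₀ : ℝ) : ℂ)) *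
        U (z - (1/2 : ℝ) • z₀)

/-- The Weyl operator with symbol `a`. -/
noncomputable def weylOp {n : ℕ} (a : ((Fin n → ℝ) × (Fin n → ℝ)) → ℂ)
    (u : (Fin n → ℝ) → ℂ) (x : Fin n → ℝ) : ℂ :=
  ((((2 * Real.pi) ^ n : ℝ)⁻¹ : ℝ) : ℂ) *
    ∫ p : (Fin n → ℝ) × (Fin n → ℝ),
      Complex.exp (Complex.I * (((x - p.1) ⬝ᵥ p.2 : ℝ) : ℂ)) *
        a ((1/2 : ℝ) • (x + p.1), p.2) * u p.1

/-- The adjoint wave-packet transform: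
`u_φ(x) = W_φ*U(x) = (2/π)^{n/2} ∫ U(z₀) e^{2iξ₀·(x−x₀)} φ(2x₀ − x) dz₀`. -/
noncomputable def adjWavePacket {n : ℕ} (U : ((Fin n → ℝ) × (Fin n → ℝ)) → ℂ)
    (φ : (Fin n → ℝ) → ℂ) (x : Fin n → ℝ) : ℂ :=
  ((Real.sqrt ((2 / Real.pi) ^ n) : ℝ) : ℂ) *
    ∫ z₀ : (Fin n → ℝ) × (Fin n → ℝ),
      U z₀ * Complex.exp (2 * Complex.I * ((z₀.2 ⬝ᵥ (x - z₀.1) : ℝ) : ℂ)) *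
        φ ((2 : ℝ) • z₀.1 - x)

/-- Fourier inversion on `ℝⁿ` with the angular-frequency normalization. -/
lemma integral_exp_mul_fourier_eq {n : ℕ} {g : (Fin n → ℝ) → ℂ} (hg : Integrable g)
    (hc : Continuous g)
    (hF : Integrable fun ξ : Fin n → ℝ =>
      ∫ x, Complex.exp (-Complex.I * ((ξ ⬝ᵥ x : ℝ) : ℂ)) * g x)
    (m : Fin n → ℝ) :
    ((((2 * Real.pi) ^ n : ℝ)⁻¹ : ℝ) : ℂ) * ∫ ξ : Fin n → ℝ,
      Complex.exp (Complex.I * ((ξ ⬝ᵥ m : ℝ) : ℂ)) *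
        ∫ x, Complex.exp (-Complex.I * ((ξ ⬝ᵥ x : ℝ) : ℂ)) * g x = g m := by
  have hpi : (0 : ℝ) < 2 * Real.pi := by positivity
  have hmp := PiLp.volume_preserving_ofLp (Fin n)
  have hme : MeasurableEmbedding (@WithLp.ofLp 2 (Fin n → ℝ)) :=
    (MeasurableEquiv.toLp 2 (Fin n → ℝ)).symm.measurableEmbedding
  set h : (Fin n → ℝ) → ℂ := fun ξ =>
    ∫ x, Complex.exp (-Complex.I * ((ξ ⬝ᵥ x : ℝ) : ℂ)) * g x
  let f : EuclideanSpace ℝ (Fin n) → ℂ := fun v => g v.ofLp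
  have hf : Integrable f := (hmp.integrable_comp_emb hme).2 hg
  have hfc : Continuous f := hc.comp (PiLp.continuous_ofLp 2 _)
  have hFf : ∀ w, FourierTransform.fourier f w = h ((2 * Real.pi) • w.ofLp) := by
    intro w
    rw [Real.fourier_eq']
    change _ = ∫ x, Complex.exp (-Complex.I * (((2 * Real.pi) • w.ofLp ⬝ᵥ x : ℝ) : ℂ)) * g x
    rw [← hmp.integral_comp hme]
    refine integral_congr_ae (.of_forall fun v => ?_)
    simp only [smul_eq_mul, f]
    congr 2
    simp only [EuclideanSpace.inner_eq_star_dotProduct, star_trivial, smul_dotProduct, smul_eq_mul]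
    push_cast
    ring
  have hfi : Integrable (FourierTransform.fourier f) := by
    rw [funext hFf]
    exact (hmp.integrable_comp_emb hme (g := fun v => h ((2 * Real.pi) • v))).2
      (hF.comp_smul hpi.ne')
  have := hf.fourierInv_fourier_eq hfi (v := WithLp.toLp 2 m) hfc.continuousAt
  rw [Real.fourierInv_eq'] at this
  simp only [f, hFf] at this
  rw [← this]
  have h2 := hmp.integral_comp hme (fun v => Complex.exp
    (Complex.I * ((((2 * Real.pi) • v) ⬝ᵥ m : ℝ) : ℂ)) * h ((2 * Real.pi) • v))
  have h3 := Measure.integral_comp_smul (volume : Measure (Fin n → ℝ))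
    (fun v => Complex.exp (Complex.I * ((v ⬝ᵥ m : ℝ) : ℂ)) * h v) (2 * Real.pi)
  rw [h3] at h2
  simp only [Module.finrank_fintype_fun_eq_card, Fintype.card_fin, Complex.real_smul] at h2
  rw [abs_of_pos (by positivity)] at h2
  rw [← h2]
  refine integral_congr_ae (.of_forall fun v => ?_)
  simp only [smul_eq_mul]
  congr 2
  simp only [EuclideanSpace.inner_eq_star_dotProduct, star_trivial, smul_dotProduct, smul_eq_mul]
  rw [dotProduct_comm]
  push_cast
  ring

/-- The symplectic Fourier transform preserves the Schwartz space. -/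
lemma exists_schwartzMap_eq_Fsigma {n : ℕ} (a : SchwartzMap ((Fin n → ℝ) × (Fin n → ℝ)) ℂ) :
    ∃ b : SchwartzMap ((Fin n → ℝ) × (Fin n → ℝ)) ℂ, ∀ z, Fsigma (fun w => a w) z = b z := by
  have hpi : (2 * Real.pi) ≠ 0 := by positivity
  let E := EuclideanSpace ℝ (Fin n)
  let L : WithLp 2 (E × E) ≃L[ℝ] ((Fin n → ℝ) × (Fin n → ℝ)) :=
    (WithLp.prodContinuousLinearEquiv 2 ℝ E E).trans
      ((EuclideanSpace.equiv (Fin n) ℝ).prodCongr (EuclideanSpace.equiv (Fin n) ℝ))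
  have hmp : MeasurePreserving L :=
    ((PiLp.volume_preserving_ofLp (Fin n)).prod (PiLp.volume_preserving_ofLp (Fin n))).comp
      (WithLp.volume_preserving_ofLp E E)
  have hme : MeasurableEmbedding L := L.toHomeomorph.measurableEmbedding
  let M : ((Fin n → ℝ) × (Fin n → ℝ)) ≃ₗ[ℝ] ((Fin n → ℝ) × (Fin n → ℝ)) :=
    { toFun := fun z => ((2 * Real.pi)⁻¹ • z.2, -((2 * Real.pi)⁻¹ • z.1))
      invFun := fun z => (-((2 * Real.pi) • z.2), (2 * Real.pi) • z.1)
      map_add' := fun z w => by ext <;> simp <;> ring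
      map_smul' := fun c z => by ext <;> simp <;> ring
      left_inv := fun z => by ext <;> simp <;> field_simp
      right_inv := fun z => by ext <;> simp <;> field_simp }
  let N : ((Fin n → ℝ) × (Fin n → ℝ)) ≃L[ℝ] WithLp 2 (E × E) :=
    M.toContinuousLinearEquiv.trans L.symm
  let c : ℂ := ((((2 * Real.pi) ^ n : ℝ)⁻¹ : ℝ) : ℂ)
  refine ⟨c • SchwartzMap.compCLMOfContinuousLinearEquiv ℂ N (FourierTransform.fourier
    (SchwartzMap.compCLMOfContinuousLinearEquiv ℂ L a)), fun z => ?_⟩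
  simp only [_root_.smul_apply, SchwartzMap.compCLMOfContinuousLinearEquiv_apply,
    Function.comp_apply, SchwartzMap.fourier_coe, Real.fourier_eq', Fsigma, smul_eq_mul]
  congr 1
  rw [← hmp.integral_comp hme]
  refine integral_congr_ae (.of_forall fun v => ?_)
  simp only
  congr 2
  have : inner ℝ v (N z) = (2 * Real.pi)⁻¹ * sigmaForm z (L v) := by
    simp only [WithLp.prod_inner_apply]
    change ((2 * Real.pi)⁻¹ • z.2) ⬝ᵥ (L v).1 + (-((2 * Real.pi)⁻¹ • z.1)) ⬝ᵥ (L v).2 = _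
    simp only [sigmaForm, smul_dotProduct, neg_dotProduct, smul_eq_mul]
    rw [dotProduct_comm (L v).2]
    ring
  rw [this, ← mul_assoc]
  have h2 : (-2 * Real.pi) * (2 * Real.pi)⁻¹ = -1 := by field_simp
  rw [h2]
  push_cast
  ring

lemma SchwartzMap.integrable_volume_prod {n : ℕ}
    (a : SchwartzMap ((Fin n → ℝ) × (Fin n → ℝ)) ℂ) : Integrable fun z => a z :=
  have : (volume : Measure ((Fin n → ℝ) × (Fin n → ℝ))).IsAddHaarMeasure :=
    Measure.prod.instIsAddHaarMeasure _ _
  a.integrable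

/-- Slices of a Schwartz function in the first variable are uniformly dominated by an integrable
function of the second variable. -/
lemma SchwartzMap.exists_integrable_bound_snd {n : ℕ}
    (a : SchwartzMap ((Fin n → ℝ) × (Fin n → ℝ)) ℂ) :
    ∃ B : (Fin n → ℝ) → ℝ, Integrable B ∧ ∀ x ξ, ‖a (x, ξ)‖ ≤ B ξ := by
  let k := n + 1
  let C := 2 ^ k * ((Finset.Iic (k, 0)).sup fun m => SchwartzMap.seminorm ℝ m.1 m.2) a
  refine ⟨fun ξ => C * (1 + ‖ξ‖) ^ (-(k : ℝ)), ?_, fun x ξ => ?_⟩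
  · exact (integrable_one_add_norm (by simp [k])).const_mul C
  · have h := SchwartzMap.one_add_le_sup_seminorm_apply (𝕜 := ℝ) (m := (k, 0)) (k := k) (n := 0)
      le_rfl le_rfl a (x, ξ)
    rw [norm_iteratedFDeriv_zero] at h
    have hp : 0 < 1 + ‖ξ‖ := by positivity
    beta_reduce
    rw [Real.rpow_neg hp.le, Real.rpow_natCast, ← div_eq_mul_inv, le_div_iff₀ (by positivity),
      mul_comm]
    refine le_trans ?_ h
    gcongr
    exact norm_snd_le (x, ξ)

lemma SchwartzMap.integrable_slice {n : ℕ} (a : SchwartzMap ((Fin n → ℝ) × (Fin n → ℝ)) ℂ)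
    (x : Fin n → ℝ) : Integrable fun ξ => a (x, ξ) := by
  obtain ⟨B, hB, hle⟩ := a.exists_integrable_bound_snd
  exact hB.mono' (a.continuous.comp (by fun_prop)).aestronglyMeasurable
    (.of_forall fun ξ => hle x ξ)

/-- Multiplying an integrable function by a continuous unimodular phase. -/
lemma MeasureTheory.Integrable.exp_I_mul {α : Type*} [TopologicalSpace α]
    [SecondCountableTopology α] [MeasurableSpace α] [OpensMeasurableSpace α] {μ : Measure α}
    {f : α → ℂ}
    (hf : Integrable f μ) {θ : α → ℝ} (hθ : Continuous θ) :
    Integrable (fun x => Complex.exp (Complex.I * (θ x : ℂ)) * f x) μ :=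
  hf.bdd_mul (c := 1) (by fun_prop) (.of_forall fun x => (Complex.norm_exp_I_mul_ofReal _).le)

/-- The Fourier integral of a Schwartz function in its second variable is continuous in the first
variable, even when the frequency varies continuously with it. -/
lemma SchwartzMap.continuous_integral_exp_slice {n : ℕ}
    (a : SchwartzMap ((Fin n → ℝ) × (Fin n → ℝ)) ℂ) {w : (Fin n → ℝ) → (Fin n → ℝ)}
    (hw : Continuous w) :
    Continuous fun x => ∫ η, Complex.exp (Complex.I * ((η ⬝ᵥ w x : ℝ) : ℂ)) * a (x, η) := by
  obtain ⟨B, hB, hle⟩ := a.exists_integrable_bound_snd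
  have ha := a.continuous
  refine continuous_of_dominated (bound := B) (fun x => ?_) (fun x => .of_forall fun η => ?_) hB
    (.of_forall fun η => ?_)
  · exact Continuous.aestronglyMeasurable (by fun_prop)
  · rw [norm_mul, Complex.norm_exp_I_mul_ofReal, one_mul]
    exact hle x η
  · fun_prop

lemma Fsigma_eq_iterated {n : ℕ} (a : SchwartzMap ((Fin n → ℝ) × (Fin n → ℝ)) ℂ)
    (y ξ : Fin n → ℝ) :
    Fsigma (fun w => a w) (y, ξ) = ((((2 * Real.pi) ^ n : ℝ)⁻¹ : ℝ) : ℂ) *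
      ∫ x, Complex.exp (-Complex.I * ((ξ ⬝ᵥ x : ℝ) : ℂ)) *
        ∫ η, Complex.exp (Complex.I * ((η ⬝ᵥ y : ℝ) : ℂ)) * a (x, η) := by
  have hphase : ∀ z : (Fin n → ℝ) × (Fin n → ℝ),
      Complex.exp (-Complex.I * ((sigmaForm (y, ξ) z : ℝ) : ℂ)) =
      Complex.exp (-Complex.I * ((ξ ⬝ᵥ z.1 : ℝ) : ℂ)) *
        Complex.exp (Complex.I * ((z.2 ⬝ᵥ y : ℝ) : ℂ)) := by
    intro z
    rw [← Complex.exp_add]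
    congr 1
    simp only [sigmaForm]
    push_cast
    ring
  have hint : Integrable fun z : (Fin n → ℝ) × (Fin n → ℝ) =>
      Complex.exp (-Complex.I * ((sigmaForm (y, ξ) z : ℝ) : ℂ)) * a z := by
    have := a.integrable_volume_prod.exp_I_mul (μ := volume)
      (θ := fun z : (Fin n → ℝ) × (Fin n → ℝ) => -sigmaForm (y, ξ) z)
      (by unfold sigmaForm; fun_prop)
    simpa using this
  rw [Fsigma, Measure.volume_eq_prod, integral_prod _ hint]
  simp only [hphase, mul_assoc, integral_const_mul]

/-- Fourier inversion in one variable for the symplectic Fourier transform. -/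
lemma integral_exp_mul_Fsigma {n : ℕ} (a : SchwartzMap ((Fin n → ℝ) × (Fin n → ℝ)) ℂ)
    (y m : Fin n → ℝ) :
    ∫ ξ, Complex.exp (Complex.I * ((ξ ⬝ᵥ m : ℝ) : ℂ)) * Fsigma (fun w => a w) (y, ξ) =
      ∫ η, Complex.exp (Complex.I * ((η ⬝ᵥ y : ℝ) : ℂ)) * a (m, η) := by
  obtain ⟨b, hb⟩ := exists_schwartzMap_eq_Fsigma a
  have hpi : ((((2 * Real.pi) ^ n : ℝ)⁻¹ : ℝ) : ℂ) ≠ 0 := by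
    exact_mod_cast (by positivity : ((2 * Real.pi) ^ n : ℝ)⁻¹ ≠ 0)
  have hg : Integrable fun x => ∫ η, Complex.exp (Complex.I * ((η ⬝ᵥ y : ℝ) : ℂ)) * a (x, η) :=
    (a.integrable_volume_prod.exp_I_mul (μ := (volume : Measure (Fin n → ℝ)).prod volume)
      (θ := fun z => z.2 ⬝ᵥ y) (by fun_prop)).integral_prod_left
  have hF := b.integrable_slice y
  simp only [← hb, Fsigma_eq_iterated] at hF
  have hF' := hF.const_mul ((((2 * Real.pi) ^ n : ℝ)⁻¹ : ℝ) : ℂ)⁻¹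
  simp only [inv_mul_cancel_left₀ hpi] at hF'
  rw [← integral_exp_mul_fourier_eq hg (a.continuous_integral_exp_slice continuous_const) hF' m,
    ← integral_const_mul]
  simp only [Fsigma_eq_iterated, mul_left_comm]

/-- The Weyl operator as a superposition of Heisenberg translations weighted by `F_σ a`. -/
lemma weylOp_eq_integral_Fsigma {n : ℕ} (a : SchwartzMap ((Fin n → ℝ) × (Fin n → ℝ)) ℂ)
    {u : (Fin n → ℝ) → ℂ} (hu : Continuous u) {C : ℝ} (hC : ∀ x, ‖u x‖ ≤ C) (x : Fin n → ℝ) :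
    weylOp (fun w => a w) u x = ((((2 * Real.pi) ^ n : ℝ)⁻¹ : ℝ) : ℂ) *
      ∫ z₀ : (Fin n → ℝ) × (Fin n → ℝ), Fsigma (fun w => a w) z₀ *
        (Complex.exp (Complex.I * ((z₀.2 ⬝ᵥ (x - (1 / 2 : ℝ) • z₀.1) : ℝ) : ℂ)) *
          u (x - z₀.1)) := by
  obtain ⟨b, hb⟩ := exists_schwartzMap_eq_Fsigma a
  rw [weylOp]
  congr 1
  have hR : Integrable (fun z₀ : (Fin n → ℝ) × (Fin n → ℝ) => Fsigma (fun w => a w) z₀ *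
        (Complex.exp (Complex.I * ((z₀.2 ⬝ᵥ (x - (1 / 2 : ℝ) • z₀.1) : ℝ) : ℂ)) *
          u (x - z₀.1))) := by
    simp only [hb]
    refine b.integrable_volume_prod.mul_bdd (c := C) (Continuous.aestronglyMeasurable (by fun_prop))
      (.of_forall fun z => ?_)
    rw [norm_mul, Complex.norm_exp_I_mul_ofReal, one_mul]
    exact hC _
  let g : (Fin n → ℝ) × (Fin n → ℝ) → (Fin n → ℝ) × (Fin n → ℝ) :=
    fun p => ((1 / 2 : ℝ) • (x + p.1), p.2)
  have hg : AntilipschitzWith 2 g := by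
    refine AntilipschitzWith.of_le_mul_dist fun p q => ?_
    simp only [g, Prod.dist_eq, dist_smul₀, dist_add_left, NNReal.coe_ofNat]
    rw [max_le_iff]
    constructor
    · refine le_trans (le_of_eq ?_) (mul_le_mul_of_nonneg_left (le_max_left _ _) zero_le_two)
      norm_num
      ring
    · refine le_trans ?_ (mul_le_mul_of_nonneg_left (le_max_right _ _) zero_le_two)
      linarith [dist_nonneg (x := p.2) (y := q.2)]
  have hgt : g.HasTemperateGrowth := by
    have hlin : g = fun p => ((1 / 2 : ℝ) • x, (0 : Fin n → ℝ)) +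
        ((1 / 2 : ℝ) • ContinuousLinearMap.fst ℝ (Fin n → ℝ) (Fin n → ℝ)).prod
          (ContinuousLinearMap.snd ℝ (Fin n → ℝ) (Fin n → ℝ)) p := by
      ext p <;> simp [g, mul_add]
    rw [hlin]
    fun_prop
  have hL : Integrable (fun p : (Fin n → ℝ) × (Fin n → ℝ) =>
      Complex.exp (Complex.I * (((x - p.1) ⬝ᵥ p.2 : ℝ) : ℂ)) *
        a ((1/2 : ℝ) • (x + p.1), p.2) * u p.1) := by
    refine Integrable.mul_bdd (c := C) (Integrable.exp_I_mul ?_ (by fun_prop))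
      (Continuous.aestronglyMeasurable (by fun_prop)) (.of_forall fun z => hC _)
    exact (SchwartzMap.compCLMOfAntilipschitz ℂ hgt hg a).integrable_volume_prod
  rw [Measure.volume_eq_prod] at hL hR ⊢
  rw [integral_prod _ hL, integral_prod _ hR, ← integral_sub_left_eq_self _ _ x]
  refine integral_congr_ae (.of_forall fun y => ?_)
  have h := integral_exp_mul_Fsigma a y (x - (1 / 2 : ℝ) • y)
  have hm : (1 / 2 : ℝ) • (x + (x - y)) = x - (1 / 2 : ℝ) • y := by
    ext i
    simp
    ring
  simp only [sub_sub_cancel, hm, integral_mul_const, dotProduct_comm y, ← h, ← mul_assoc]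
  simp only [mul_comm]

/-- The wave packet (Grossmann–Royer reflection) `e^{2iξ₀·(x−x₀)} φ(2x₀ − x)`. -/
noncomputable def wavePacket {n : ℕ} (φ : (Fin n → ℝ) → ℂ) (x : Fin n → ℝ)
    (z : (Fin n → ℝ) × (Fin n → ℝ)) : ℂ :=
  Complex.exp (2 * Complex.I * ((z.2 ⬝ᵥ (x - z.1) : ℝ) : ℂ)) * φ ((2 : ℝ) • z.1 - x)

lemma norm_wavePacket {n : ℕ} (φ : (Fin n → ℝ) → ℂ) (x : Fin n → ℝ)
    (z : (Fin n → ℝ) × (Fin n → ℝ)) : ‖wavePacket φ x z‖ = ‖φ ((2 : ℝ) • z.1 - x)‖ := by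
  rw [wavePacket, norm_mul, mul_comm 2, mul_assoc, ← Complex.ofReal_ofNat, ← Complex.ofReal_mul,
    Complex.norm_exp_I_mul_ofReal, one_mul]

lemma adjWavePacket_eq {n : ℕ} (U : (Fin n → ℝ) × (Fin n → ℝ) → ℂ) (φ : (Fin n → ℝ) → ℂ)
    (x : Fin n → ℝ) : adjWavePacket U φ x =
      ((Real.sqrt ((2 / Real.pi) ^ n) : ℝ) : ℂ) * ∫ z, U z * wavePacket φ x z := by
  simp only [adjWavePacket, wavePacket, mul_assoc]

/-- Heisenberg translations act on wave packets by translating them in phase space. -/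
lemma exp_mul_wavePacket_sub {n : ℕ} (φ : (Fin n → ℝ) → ℂ) (x : Fin n → ℝ)
    (z z₀ : (Fin n → ℝ) × (Fin n → ℝ)) :
    Complex.exp (Complex.I * ((z₀.2 ⬝ᵥ (x - (1 / 2 : ℝ) • z₀.1) : ℝ) : ℂ)) *
        wavePacket φ (x - z₀.1) (z - (1 / 2 : ℝ) • z₀) =
      Complex.exp (-Complex.I * ((sigmaForm z z₀ : ℝ) : ℂ)) * wavePacket φ x z := by
  have hφ : (2 : ℝ) • (z - (1 / 2 : ℝ) • z₀).1 - (x - z₀.1) = (2 : ℝ) • z.1 - x := by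
    ext i
    simp
    ring
  simp only [wavePacket, hφ, ← mul_assoc, ← Complex.exp_add]
  congr 2
  simp only [sigmaForm, Prod.fst_sub, Prod.snd_sub, Prod.smul_fst, Prod.smul_snd, dotProduct_sub,
    sub_dotProduct, smul_dotProduct, dotProduct_smul, smul_eq_mul]
  push_cast
  ring

lemma continuous_wavePacket {n : ℕ} (φ : SchwartzMap (Fin n → ℝ) ℂ) (x : Fin n → ℝ) :
    Continuous (wavePacket (fun w => φ w) x) := by
  have := φ.continuous
  unfold wavePacket
  fun_prop

lemma continuous_wavePacket_left {n : ℕ} (φ : SchwartzMap (Fin n → ℝ) ℂ)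
    (z : (Fin n → ℝ) × (Fin n → ℝ)) : Continuous fun x => wavePacket (fun w => φ w) x z := by
  have := φ.continuous
  unfold wavePacket
  fun_prop

lemma norm_wavePacket_le {n : ℕ} (φ : SchwartzMap (Fin n → ℝ) ℂ) (x : Fin n → ℝ)
    (z : (Fin n → ℝ) × (Fin n → ℝ)) :
    ‖wavePacket (fun w => φ w) x z‖ ≤ SchwartzMap.seminorm ℝ 0 0 φ := by
  rw [norm_wavePacket]
  exact φ.norm_le_seminorm ℝ _

lemma norm_adjWavePacket_le {n : ℕ} (U : SchwartzMap ((Fin n → ℝ) × (Fin n → ℝ)) ℂ)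
    (φ : SchwartzMap (Fin n → ℝ) ℂ) (x : Fin n → ℝ) :
    ‖adjWavePacket (fun w => U w) (fun w => φ w) x‖ ≤
      Real.sqrt ((2 / Real.pi) ^ n) * ∫ z, ‖U z‖ * SchwartzMap.seminorm ℝ 0 0 φ := by
  rw [adjWavePacket_eq, norm_mul, Complex.norm_real, Real.norm_of_nonneg (Real.sqrt_nonneg _)]
  gcongr
  refine norm_integral_le_of_norm_le (U.integrable_volume_prod.norm.mul_const _)
    (.of_forall fun z => ?_)
  rw [norm_mul]
  gcongr
  exact norm_wavePacket_le φ x z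

lemma continuous_adjWavePacket {n : ℕ} (U : SchwartzMap ((Fin n → ℝ) × (Fin n → ℝ)) ℂ)
    (φ : SchwartzMap (Fin n → ℝ) ℂ) :
    Continuous (adjWavePacket (fun w => U w) (fun w => φ w)) := by
  have hU := U.continuous
  rw [funext (adjWavePacket_eq _ _)]
  refine continuous_const.mul (continuous_of_dominated
    (bound := fun z => ‖U z‖ * SchwartzMap.seminorm ℝ 0 0 φ) (fun x => ?_)
    (fun x => .of_forall fun z => ?_) (U.integrable_volume_prod.norm.mul_const _)
    (.of_forall fun z => ?_))
  · exact (hU.mul (continuous_wavePacket φ x)).aestronglyMeasurable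
  · rw [norm_mul]
    gcongr
    exact norm_wavePacket_le φ x z
  · exact continuous_const.mul (continuous_wavePacket_left φ z)

/-- The adjoint wave-packet transform intertwines the phase-space operator `Ã` with the Weyl
operator. -/
lemma weylOp_adjWavePacket {n : ℕ} (a U : SchwartzMap ((Fin n → ℝ) × (Fin n → ℝ)) ℂ)
    (φ : SchwartzMap (Fin n → ℝ) ℂ) (x : Fin n → ℝ) :
    weylOp (fun w => a w) (adjWavePacket (fun w => U w) (fun w => φ w)) x =
      adjWavePacket (AtildeSigma (fun w => a w) (fun w => U w)) (fun w => φ w) x := by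
  obtain ⟨b, hb⟩ := exists_schwartzMap_eq_Fsigma a
  have : (volume : Measure ((Fin n → ℝ) × (Fin n → ℝ))).IsAddHaarMeasure :=
    Measure.prod.instIsAddHaarMeasure _ _
  have hUc := U.continuous
  have hbc := b.continuous
  have hWc := continuous_wavePacket φ x
  have hσ : Continuous fun p : ((Fin n → ℝ) × (Fin n → ℝ)) × ((Fin n → ℝ) × (Fin n → ℝ)) =>
      sigmaForm p.2 p.1 := by
    unfold sigmaForm
    fun_prop
  let K : (Fin n → ℝ) × (Fin n → ℝ) → (Fin n → ℝ) × (Fin n → ℝ) → ℂ := fun z₀ z =>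
    b z₀ * (U (z - (1 / 2 : ℝ) • z₀) * (Complex.exp (-Complex.I * ((sigmaForm z z₀ : ℝ) : ℂ)) *
      wavePacket (fun w => φ w) x z))
  have hKc : Continuous (Function.uncurry K) := by
    simp only [K, Function.uncurry_def]
    fun_prop
  have hK : Integrable (Function.uncurry K)
      ((volume : Measure ((Fin n → ℝ) × (Fin n → ℝ))).prod volume) := by
    have hdom : Integrable
        (fun p : ((Fin n → ℝ) × (Fin n → ℝ)) × ((Fin n → ℝ) × (Fin n → ℝ)) =>
          b p.1 * U (p.2 - (1 / 2 : ℝ) • p.1))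
        ((volume : Measure ((Fin n → ℝ) × (Fin n → ℝ))).prod volume) := by
      refine (integrable_prod_iff (Continuous.aestronglyMeasurable (by fun_prop))).2 ⟨?_, ?_⟩
      · exact .of_forall fun z₀ =>
          (U.integrable_volume_prod.comp_sub_right ((1 / 2 : ℝ) • z₀)).const_mul (b z₀)
      · simp only [norm_mul, integral_const_mul]
        have htr : ∀ z₀, ∫ z, ‖U (z - (1 / 2 : ℝ) • z₀)‖ = ∫ z, ‖U z‖ := fun z₀ =>
          integral_sub_right_eq_self (fun z => ‖U z‖) _
        simp only [htr]
        exact b.integrable_volume_prod.norm.mul_const _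
    refine (hdom.mul_const ((SchwartzMap.seminorm ℝ 0 0 φ : ℝ) : ℂ)).mono
      hKc.aestronglyMeasurable (.of_forall fun p => ?_)
    have hexp : ‖Complex.exp (-Complex.I * ((sigmaForm p.2 p.1 : ℝ) : ℂ))‖ = 1 := by
      rw [neg_mul, ← mul_neg, ← Complex.ofReal_neg, Complex.norm_exp_I_mul_ofReal]
    simp only [Function.uncurry_def, K, norm_mul, hexp, one_mul, Complex.norm_real]
    rw [← mul_assoc]
    gcongr
    exact (norm_wavePacket_le φ x _).trans (le_abs_self _)
  rw [weylOp_eq_integral_Fsigma a (continuous_adjWavePacket U φ) (norm_adjWavePacket_le U φ) x]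
  have hleft : ∀ z₀ : (Fin n → ℝ) × (Fin n → ℝ), Fsigma (fun w => a w) z₀ *
      (Complex.exp (Complex.I * ((z₀.2 ⬝ᵥ (x - (1 / 2 : ℝ) • z₀.1) : ℝ) : ℂ)) *
        adjWavePacket (fun w => U w) (fun w => φ w) (x - z₀.1)) =
      ((Real.sqrt ((2 / Real.pi) ^ n) : ℝ) : ℂ) * ∫ z, K z₀ z := by
    intro z₀
    rw [adjWavePacket_eq, ← integral_sub_right_eq_self _ ((1 / 2 : ℝ) • z₀)]
    simp only [K, integral_const_mul, hb, ← exp_mul_wavePacket_sub]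
    simp only [mul_left_comm (U _), integral_const_mul]
    ring
  simp only [hleft, integral_const_mul]
  rw [integral_integral_swap hK, adjWavePacket_eq]
  have hright : ∀ z, AtildeSigma (fun w => a w) (fun w => U w) z *
      wavePacket (fun w => φ w) x z =
      ((((2 * Real.pi) ^ n : ℝ)⁻¹ : ℝ) : ℂ) * ∫ z₀, K z₀ z := by
    intro z
    rw [AtildeSigma, mul_assoc, ← integral_mul_const]
    congr 2
    ext z₀
    simp only [K, hb]
    ring
  simp only [hright, integral_const_mul]
  ring

/-- A function annihilated by all adjoint wave-packet transforms vanishes. -/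
lemma SchwartzMap.eq_zero_of_adjWavePacket_eq_zero {n : ℕ}
    (U : SchwartzMap ((Fin n → ℝ) × (Fin n → ℝ)) ℂ)
    (h : ∀ φ : SchwartzMap (Fin n → ℝ) ℂ, adjWavePacket (fun w => U w) (fun w => φ w) = 0) :
    U = 0 := by
  have hpi : (0 : ℝ) < 2 / Real.pi := by positivity
  have hconst : ((Real.sqrt ((2 / Real.pi) ^ n) : ℝ) : ℂ) ≠ 0 := by
    exact_mod_cast (Real.sqrt_pos.2 (pow_pos hpi n)).ne'
  have hG : ∀ x p : Fin n → ℝ,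
      ∫ ξ, Complex.exp (Complex.I * ((ξ ⬝ᵥ ((2 : ℝ) • (x - p)) : ℝ) : ℂ)) * U (p, ξ) = 0 := by
    intro x
    have hGc := U.continuous_integral_exp_slice (w := fun p => (2 : ℝ) • (x - p)) (by fun_prop)
    suffices hae : ∀ᵐ p : Fin n → ℝ,
        ∫ ξ, Complex.exp (Complex.I * ((ξ ⬝ᵥ ((2 : ℝ) • (x - p)) : ℝ) : ℂ)) * U (p, ξ) = 0 from
      congrFun (Continuous.ae_eq_iff_eq volume hGc continuous_const |>.1 hae)
    refine ae_eq_zero_of_integral_contDiff_smul_eq_zero hGc.locallyIntegrable fun g hg hgc => ?_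
    let f : (Fin n → ℝ) → ℂ := fun y => (g ((1 / 2 : ℝ) • (y + x)) : ℂ)
    have hfd : ContDiff ℝ ((⊤ : ℕ∞) : WithTop ℕ∞) f :=
      Complex.ofRealCLM.contDiff.comp (hg.comp (by fun_prop))
    have hfc : HasCompactSupport f := by
      refine HasCompactSupport.comp_left (g := fun t : ℝ => (t : ℂ)) ?_ (by simp)
      exact hgc.comp_homeomorph ((Homeomorph.addRight x).trans
        (Homeomorph.smulOfNeZero (1 / 2 : ℝ) (by norm_num)))
    have h0 := congrFun (h (hfc.toSchwartzMap hfd)) x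
    rw [adjWavePacket_eq, Pi.zero_apply, mul_eq_zero, or_iff_right hconst] at h0
    have hint : Integrable (fun z : (Fin n → ℝ) × (Fin n → ℝ) =>
        U z * wavePacket (fun w => hfc.toSchwartzMap hfd w) x z)
        ((volume : Measure (Fin n → ℝ)).prod volume) :=
      U.integrable_volume_prod.mul_bdd (c := SchwartzMap.seminorm ℝ 0 0 (hfc.toSchwartzMap hfd))
        (continuous_wavePacket _ x).aestronglyMeasurable
        (.of_forall fun z => norm_wavePacket_le _ x z)
    rw [Measure.volume_eq_prod, integral_prod _ hint] at h0
    rw [← h0]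
    refine integral_congr_ae (.of_forall fun p => ?_)
    simp only [Complex.real_smul]
    rw [← integral_const_mul]
    refine integral_congr_ae (.of_forall fun ξ => ?_)
    have hp : (1 / 2 : ℝ) • ((2 : ℝ) • p - x + x) = p := by
      ext i
      simp
    simp only [wavePacket, HasCompactSupport.toSchwartzMap_toFun, f, hp, dotProduct_smul,
      smul_eq_mul]
    push_cast
    ring_nf
  ext ⟨p, m⟩
  have hF : ∀ ξ : Fin n → ℝ,
      ∫ η, Complex.exp (-Complex.I * ((ξ ⬝ᵥ η : ℝ) : ℂ)) * U (p, η) = 0 := by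
    intro ξ
    rw [← hG (p - (1 / 2 : ℝ) • ξ) p]
    congr 1
    ext η
    have hs : (2 : ℝ) • (p - (1 / 2 : ℝ) • ξ - p) = -ξ := by
      ext i
      simp
    rw [hs, dotProduct_neg, dotProduct_comm ξ]
    push_cast
    ring_nf
  have hinv := integral_exp_mul_fourier_eq (U.integrable_slice p)
    (U.continuous.comp (Continuous.prodMk_right p)) (by simp only [hF]; exact integrable_zero _ _ _)
    m
  simp only [hF, mul_zero, integral_zero] at hinv
  exact hinv.symm

/-- if `ÃU = λU` with `U ∈ 𝒮(ℝ^{2n})`, then (i) for every window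
`φ`, `Â(W_φ*U) = λ·(W_φ*U)`; and (ii) if `U ≠ 0`, then `W_φ*U ≠ 0` for some
`φ`, so `λ` is an eigenvalue of `Â`. -/
theorem stmt17 (n : ℕ) (hn : 1 ≤ n)
    (a : SchwartzMap ((Fin n → ℝ) × (Fin n → ℝ)) ℂ) (lam : ℂ)
    (U : SchwartzMap ((Fin n → ℝ) × (Fin n → ℝ)) ℂ)
    (hU : ∀ z, AtildeSigma (fun w => a w) (fun w => U w) z = lam * U z) :
    (∀ φ : SchwartzMap (Fin n → ℝ) ℂ, ∀ x : Fin n → ℝ,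
        weylOp (fun w => a w) (adjWavePacket (fun w => U w) (fun w => φ w)) x
          = lam * adjWavePacket (fun w => U w) (fun w => φ w) x)
      ∧ (U ≠ 0 → ∃ φ : SchwartzMap (Fin n → ℝ) ℂ,
          adjWavePacket (fun w => U w) (fun w => φ w) ≠ 0) := by
  refine ⟨fun φ x => ?_, fun hU0 => ?_⟩
  · rw [weylOp_adjWavePacket, funext hU, adjWavePacket_eq, adjWavePacket_eq]
    simp only [mul_assoc, integral_const_mul, mul_left_comm]
  · by_contra! h
    exact hU0 (U.eq_zero_of_adjWavePacket_eq_zero h)
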